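/- arXiv:1705.10607 — 3 statements merged into one kernel-verified Lean document; each statement's English description precedes it below -/
import Mathlib

section
/- Let G be a group, Q = Conj(G) its conjugation quandle, and φ an automorphism of the quandle Q. Then for all x, y ∈ G there exists an element z in the center Z(G) such that φ(xy) = φ(x)φ(y)z. -/
/-- If `φ` is an automorphism of the conjugation quandle of a group `G` (with operation
`x * y = y⁻¹xy`), then for all `x, y ∈ G` there is a central element `z` with
`φ(xy) = φ(x)φ(y)z`. -/
theorem conj_quandle_aut_almost_hom {G : Type*} [Group G] (φ : Equiv.Perm G)
    (hφ : ∀ x y : G, φ (y⁻¹ * x * y) = (φ y)⁻¹ * φ x * φ y) :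
    ∀ x y : G, ∃ z ∈ Subgroup.center G, φ (x * y) = φ x * φ y * z := by
  intro x y
  have conj_eq (b : G) :
      (φ (x * y))⁻¹ * b * φ (x * y) = (φ x * φ y)⁻¹ * b * (φ x * φ y) := by
    obtain ⟨a, rfl⟩ := φ.surjective b
    calc (φ (x * y))⁻¹ * φ a * φ (x * y) = φ (y⁻¹ * (x⁻¹ * a * x) * y) := by
          rw [← hφ]; congr 1; group
      _ = (φ x * φ y)⁻¹ * φ a * (φ x * φ y) := by
          rw [hφ, hφ]; group
  refine ⟨(φ x * φ y)⁻¹ * φ (x * y), Subgroup.mem_center_iff.mpr fun g => ?_, by group⟩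
  have h := conj_eq (φ (x * y) * g * (φ (x * y))⁻¹)
  generalize φ (x * y) = r at h ⊢
  generalize φ x * φ y = s at h ⊢
  calc g * (s⁻¹ * r) = (r⁻¹ * (r * g * r⁻¹) * r) * (s⁻¹ * r) := by group
    _ = s⁻¹ * r * g := by rw [h]; group
end

section
/- Let G be a group. Then every quandle automorphism of the conjugation quandle Conj(G) is a group automorphism of G (that is, Aut(G) = Aut(Conj(G))) if and only if the center of G is trivial. -/
/-- Transposing the identity with a central element preserves conjugation. -/
theorem swap_one_conj_of_mem_center {G : Type*} [Group G] [DecidableEq G] {z : G}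
    (hz : z ∈ Subgroup.center G) (x y : G) :
    Equiv.swap 1 z (y⁻¹ * x * y) =
      (Equiv.swap 1 z y)⁻¹ * Equiv.swap 1 z x * Equiv.swap 1 z y := by
  have hc : ∀ g : G, g⁻¹ * z * g = z := fun g => by
    rw [mul_assoc, ← Subgroup.mem_center_iff.mp hz g, inv_mul_cancel_left]
  have hc' : ∀ g : G, z⁻¹ * g * z = g := fun g => by
    rw [mul_assoc, Subgroup.mem_center_iff.mp hz g, inv_mul_cancel_left]
  have hy : ∀ g : G, (Equiv.swap 1 z y)⁻¹ * g * Equiv.swap 1 z y = y⁻¹ * g * y := fun g => by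
    rcases eq_or_ne y 1 with rfl | h1
    · simp [hc']
    rcases eq_or_ne y z with rfl | h2
    · simp [hc']
    · rw [Equiv.swap_apply_of_ne_of_ne h1 h2]
  rw [hy]
  rcases eq_or_ne x 1 with rfl | h1
  · simp [hc]
  rcases eq_or_ne x z with rfl | h2
  · simp [hc]
  have inj : ∀ a : G, y⁻¹ * x * y = y⁻¹ * a * y → x = a := fun a h =>
    mul_left_cancel (mul_right_cancel h)
  rw [Equiv.swap_apply_of_ne_of_ne h1 h2, Equiv.swap_apply_of_ne_of_ne]
  · exact fun h => h1 (inj 1 (by simpa using h))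
  · exact fun h => h2 (inj z (by rw [hc, h]))

/-- Every quandle automorphism of the conjugation quandle `Conj(G)` (with operation
`x * y = y⁻¹xy`) is an automorphism of the group `G` if and only if the center of `G`
is trivial. -/
theorem conj_quandle_aut_eq_group_aut_iff {G : Type*} [Group G] :
    (∀ φ : Equiv.Perm G, (∀ x y : G, φ (y⁻¹ * x * y) = (φ y)⁻¹ * φ x * φ y) →
      ∀ x y : G, φ (x * y) = φ x * φ y) ↔ Subgroup.center G = ⊥ := by
  classical
  constructor
  · refine fun h => (Subgroup.eq_bot_iff_forall _).mpr fun z hz => ?_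
    simpa using h (Equiv.swap 1 z) (swap_one_conj_of_mem_center hz) 1 1
  · intro hZ φ hφ x y
    have key : φ (x * y) * (φ x * φ y)⁻¹ ∈ Subgroup.center G := by
      rw [Subgroup.mem_center_iff]
      intro g
      obtain ⟨w, rfl⟩ := φ.surjective g
      have e : (φ (x * y))⁻¹ * φ w * φ (x * y) = (φ x * φ y)⁻¹ * φ w * (φ x * φ y) := by
        calc (φ (x * y))⁻¹ * φ w * φ (x * y) = φ (y⁻¹ * (x⁻¹ * w * x) * y) := by
              rw [← hφ]; congr 1; group
          _ = (φ x * φ y)⁻¹ * φ w * (φ x * φ y) := by rw [hφ, hφ]; group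
      calc φ w * (φ (x * y) * (φ x * φ y)⁻¹)
          = φ (x * y) * ((φ (x * y))⁻¹ * φ w * φ (x * y)) * (φ x * φ y)⁻¹ := by group
        _ = φ (x * y) * (φ x * φ y)⁻¹ * φ w := by rw [e]; group
    rw [hZ, Subgroup.mem_bot] at key
    exact mul_inv_eq_one.mp key
end

section
/- Let G be a finite group. Then every quandle automorphism ψ of the conjugation quandle Conj(G) can be written as ψ(x) = φ(x)·a for all x ∈ G, for some group automorphism φ of G and some fixed element a ∈ Z(G), if and only if either the center Z(G) is trivial or G is isomorphic to one of the groups Z/2Z, Z/2Z × Z/2Z, or Z/3Z. (Equivalently, Aut(Conj(G)) = Z(G) ⋊ Aut(G) if and only if Z(G) = 1 or G ∈ {Z_2, Z_2^2, Z_3}.) -/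
/-- A permutation of a group is a group automorphism followed by a translation by a central
element as soon as it is multiplicative up to its central value at the identity. -/
theorem exists_mulAut_mul_center {G : Type*} [Group G] (ψ : Equiv.Perm G)
    (h1 : ψ 1 ∈ Subgroup.center G) (hmul : ∀ x y : G, ψ (x * y) * ψ 1 = ψ x * ψ y) :
    ∃ (φ : MulAut G) (a : G), a ∈ Subgroup.center G ∧ ∀ x : G, ψ x = φ x * a := by
  refine ⟨MulEquiv.mk' (ψ.trans (Equiv.mulRight (ψ 1)⁻¹)) fun x y => ?_, ψ 1, h1, fun x => ?_⟩
  · have hc := Subgroup.mem_center_iff.mp (inv_mem h1) (ψ y)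
    change ψ (x * y) * (ψ 1)⁻¹ = ψ x * (ψ 1)⁻¹ * (ψ y * (ψ 1)⁻¹)
    rw [eq_mul_inv_of_mul_eq (hmul x y), mul_assoc (ψ x) (ψ 1)⁻¹, ← mul_assoc (ψ 1)⁻¹, ← hc]
    simp only [mul_assoc]
  · exact (inv_mul_cancel_right _ _).symm

/-- A permutation compatible with conjugation sends the identity to a central element. -/
theorem map_one_mem_center {G : Type*} [Group G] (ψ : Equiv.Perm G)
    (hψ : ∀ x y : G, ψ (y⁻¹ * x * y) = (ψ y)⁻¹ * ψ x * ψ y) : ψ 1 ∈ Subgroup.center G := by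
  refine Subgroup.mem_center_iff.mpr fun g => ?_
  obtain ⟨x, rfl⟩ := ψ.surjective g
  have h := hψ x 1
  rw [inv_one, one_mul, mul_one, mul_assoc, eq_inv_mul_iff_mul_eq] at h
  exact h.symm

/-- In a group with trivial center, a permutation compatible with conjugation is
multiplicative. -/
theorem map_mul_of_center_eq_bot {G : Type*} [Group G] (hZ : Subgroup.center G = ⊥)
    (ψ : Equiv.Perm G) (hψ : ∀ x y : G, ψ (y⁻¹ * x * y) = (ψ y)⁻¹ * ψ x * ψ y) (x y : G) :
    ψ (x * y) = ψ x * ψ y := by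
  have hc : ψ x * ψ y * (ψ (x * y))⁻¹ ∈ Subgroup.center G := by
    refine Subgroup.mem_center_iff.mpr fun g => ?_
    obtain ⟨w, rfl⟩ := ψ.surjective g
    have h : (ψ (x * y))⁻¹ * ψ w * ψ (x * y) = (ψ y)⁻¹ * ((ψ x)⁻¹ * ψ w * ψ x) * ψ y := by
      rw [← hψ, ← hψ, ← hψ]
      congr 1
      group
    calc ψ w * (ψ x * ψ y * (ψ (x * y))⁻¹)
        = ψ x * ψ y * ((ψ y)⁻¹ * ((ψ x)⁻¹ * ψ w * ψ x) * ψ y) * (ψ (x * y))⁻¹ := by group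
      _ = ψ x * ψ y * (ψ (x * y))⁻¹ * ψ w := by rw [← h]; group
  rw [hZ, Subgroup.mem_bot, mul_inv_eq_one] at hc
  exact hc.symm

/-- If every permutation of an additive group `A` is affine, then so is every permutation of a
group isomorphic to `A`. -/
theorem exists_mulAut_mul_center_of_mulEquiv {G A : Type*} [Group G] [AddCommGroup A]
    (hA : ∀ f : Equiv.Perm A, ∀ x y : A, f (x + y) + f 0 = f x + f y)
    (e : G ≃* Multiplicative A) (ψ : Equiv.Perm G) :
    ∃ (φ : MulAut G) (a : G), a ∈ Subgroup.center G ∧ ∀ x : G, ψ x = φ x * a := by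
  refine exists_mulAut_mul_center ψ (Subgroup.mem_center_iff.mpr fun g => ?_) fun x y => ?_
  · apply e.injective
    rw [map_mul, map_mul, mul_comm]
  · let ε : G ≃ A := e.toEquiv.trans Multiplicative.toAdd
    have hε (x y : G) : ε (x * y) = ε x + ε y := congrArg Multiplicative.toAdd (map_mul e x y)
    have hε1 : ε 1 = 0 := congrArg Multiplicative.toAdd (map_one e)
    apply ε.injective
    have h := hA (ε.permCongr ψ) (ε x) (ε y)
    rw [← hε, ← hε1] at h
    simpa only [Equiv.permCongr_apply, Equiv.symm_apply_apply, ← hε, ε.injective.eq_iff] using h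

/-- If every quandle automorphism of the conjugation quandle is a group automorphism followed by
a central translation and the center is nontrivial, then the group is commutative: multiplying
the central elements by a central `z ≠ 1` and fixing everything else is a quandle automorphism
which is not of that form in a noncommutative group. -/
theorem commute_of_forall_exists_mulAut {G : Type*} [Group G]
    (H : ∀ ψ : Equiv.Perm G, (∀ x y : G, ψ (y⁻¹ * x * y) = (ψ y)⁻¹ * ψ x * ψ y) →
      ∃ (φ : MulAut G) (a : G), a ∈ Subgroup.center G ∧ ∀ x : G, ψ x = φ x * a)
    (hZ : Subgroup.center G ≠ ⊥) (x y : G) : x * y = y * x := by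
  classical
  by_contra hxy
  obtain ⟨z, hz, hz1⟩ := (Subgroup.bot_or_exists_ne_one (Subgroup.center G)).resolve_left hZ
  have hzc := Subgroup.mem_center_iff.mp hz
  let ψ : Equiv.Perm G :=
    { toFun := fun x => if x ∈ Subgroup.center G then x * z else x
      invFun := fun x => if x ∈ Subgroup.center G then x * z⁻¹ else x
      left_inv := fun x => by
        by_cases hx : x ∈ Subgroup.center G <;> simp [hx, mul_mem_cancel_right hz]
      right_inv := fun x => by
        by_cases hx : x ∈ Subgroup.center G <;>
          simp [hx, mul_mem_cancel_right (inv_mem hz)] }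
  have hψ_mem {x : G} (hx : x ∈ Subgroup.center G) : ψ x = x * z := if_pos hx
  have hψ_not {x : G} (hx : x ∉ Subgroup.center G) : ψ x = x := if_neg hx
  have hψ_conj (g y : G) : (ψ y)⁻¹ * g * ψ y = y⁻¹ * g * y := by
    by_cases hy : y ∈ Subgroup.center G
    · rw [hψ_mem hy, mul_assoc, ← mul_assoc g, hzc (g * y), hzc y]
      group
    · rw [hψ_not hy]
  obtain ⟨φ, a, ha, hφ⟩ := H ψ fun u v => by
    rw [hψ_conj]
    by_cases hu : u ∈ Subgroup.center G
    · have h : v⁻¹ * u * v = u := by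
        rw [mul_assoc, ← Subgroup.mem_center_iff.mp hu v, inv_mul_cancel_left]
      have h' : v⁻¹ * (u * z) * v = u * z := by
        rw [mul_assoc, ← Subgroup.mem_center_iff.mp (mul_mem hu hz) v, inv_mul_cancel_left]
      rw [h, hψ_mem hu, h']
    · have h : v⁻¹ * u * v ∉ Subgroup.center G := fun h => hu <| by
        have := (inferInstance : (Subgroup.center G).Normal).conj_mem _ h v
        simpa [mul_assoc] using this
      rw [hψ_not h, hψ_not hu]
  have hx : x ∉ Subgroup.center G := fun h => hxy (Subgroup.mem_center_iff.mp h y).symm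
  have hy : y ∉ Subgroup.center G := fun h => hxy (Subgroup.mem_center_iff.mp h x)
  have hm : x * y ∉ Subgroup.center G := fun h => hxy <| by
    have := Subgroup.mem_center_iff.mp h x
    rw [mul_assoc, mul_right_inj] at this
    exact this
  have h1 := hφ 1
  rw [hψ_mem (one_mem _), one_mul, map_one, one_mul] at h1
  have hX := hφ x
  have hY := hφ y
  have hXY := hφ (x * y)
  rw [hψ_not hx] at hX
  rw [hψ_not hy] at hY
  rw [hψ_not hm, map_mul] at hXY
  apply hz1
  have h : x * y = x * y * a :=
    calc x * y = φ x * a * (φ y * a) := by rw [← hX, ← hY]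
      _ = φ x * φ y * a * a := by
        rw [mul_assoc (φ x), ← mul_assoc a, ← Subgroup.mem_center_iff.mp ha (φ y)]
        simp only [mul_assoc]
      _ = x * y * a := by rw [← hXY]
  exact h1.trans (mul_eq_left.mp h.symm)

/-- If the transposition of `a` and `b` extends to a group automorphism fixing everything else,
then every further nontrivial element `c` satisfies `a * c = b`. -/
theorem mul_eq_of_swap_eq_mulAut {G : Type*} [Group G] [DecidableEq G] {a b c : G}
    (φ : MulAut G) (hφ : ∀ x, Equiv.swap a b x = φ x) (hab : a ≠ b) (hca : c ≠ a) (hcb : c ≠ b)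
    (hc1 : c ≠ 1) : a * c = b := by
  have h := map_mul φ a c
  rw [← hφ, ← hφ, ← hφ, Equiv.swap_apply_left, Equiv.swap_apply_of_ne_of_ne hca hcb] at h
  by_contra hne
  rw [Equiv.swap_apply_of_ne_of_ne (fun h' => hc1 (mul_eq_left.mp h')) hne, mul_left_inj] at h
  exact hab h

/-- A finite group all of whose permutations are affine has order at most `3` or is a Klein
four-group. -/
theorem card_le_three_or_isKleinFour {G : Type*} [Group G] [Finite G]
    (H : ∀ ψ : Equiv.Perm G, ∃ (φ : MulAut G) (a : G), ∀ x : G, ψ x = φ x * a) :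
    Nat.card G ≤ 3 ∨ IsKleinFour G := by
  classical
  have := Fintype.ofFinite G
  have key {a b c : G} (ha : a ≠ 1) (hb : b ≠ 1) (hc : c ≠ 1) (hab : a ≠ b) (hca : c ≠ a)
      (hcb : c ≠ b) : a * c = b := by
    obtain ⟨φ, t, h⟩ := H (Equiv.swap a b)
    have ht := h 1
    rw [Equiv.swap_apply_of_ne_of_ne ha.symm hb.symm, map_one, one_mul] at ht
    exact mul_eq_of_swap_eq_mulAut φ (fun x => by rw [h, ← ht, mul_one]) hab hca hcb hc
  refine or_iff_not_imp_left.mpr fun hcard => ?_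
  have h2 : 2 < (Finset.univ.erase (1 : G)).card := by
    rw [Finset.card_erase_of_mem (Finset.mem_univ _), Finset.card_univ, ← Nat.card_eq_fintype_card]
    omega
  obtain ⟨a, ha, b, hb, c, hc, hab, hac, hbc⟩ := Finset.two_lt_card.mp h2
  simp only [Finset.mem_erase, Finset.mem_univ, and_true] at ha hb hc
  have hsq {a b c : G} (ha : a ≠ 1) (hb : b ≠ 1) (hc : c ≠ 1) (hab : a ≠ b) (hac : a ≠ c)
      (hbc : b ≠ c) : c ^ 2 = 1 := by
    have h := key ha hb hc hab hac.symm hbc.symm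
    rw [← key hb ha hc hab.symm hbc.symm hac.symm, mul_assoc] at h
    rw [sq]
    exact mul_eq_left.mp h
  have huniv (d : G) : d = 1 ∨ d = a ∨ d = b ∨ d = c := by
    by_contra! hd
    obtain ⟨hd1, hda, hdb, hdc⟩ := hd
    exact hdc <| mul_left_cancel <|
      (key ha hb hd1 hab hda hdb).trans (key ha hb hc hab hac.symm hbc.symm).symm
  have : Nontrivial G := ⟨a, 1, ha⟩
  refine ⟨?_, (Monoid.exponent_eq_prime_iff Nat.prime_two).mpr fun d hd => ?_⟩
  · have hle : (Finset.univ : Finset G).card ≤ 4 :=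
      (Finset.card_le_card fun d _ =>
        show d ∈ ({1, a, b, c} : Finset G) by simpa using huniv d).trans
        Finset.card_le_four
    rw [Finset.card_univ, ← Nat.card_eq_fintype_card] at hle
    omega
  · refine orderOf_eq_prime ?_ hd
    rcases huniv d with rfl | rfl | rfl | rfl
    · exact one_pow 2
    · exact hsq hb hc hd hbc hab.symm hac.symm
    · exact hsq ha hc hd hac hab hbc.symm
    · exact hsq ha hb hd hab hac hbc

/-- For a finite group `G`, every quandle automorphism `ψ` of the conjugation quandle
`Conj(G)` is of the form `ψ(x) = φ(x)·a` for a group automorphism `φ` of `G` and a fixed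
central element `a` (equivalently, `Aut(Conj(G)) = Z(G) ⋊ Aut(G)`), if and only if the
center of `G` is trivial or `G` is one of `ℤ/2ℤ`, `ℤ/2ℤ × ℤ/2ℤ`, `ℤ/3ℤ`. -/
theorem conj_quandle_aut_semidirect_iff {G : Type*} [Group G] [Finite G] :
    (∀ ψ : Equiv.Perm G, (∀ x y : G, ψ (y⁻¹ * x * y) = (ψ y)⁻¹ * ψ x * ψ y) →
      ∃ (φ : MulAut G) (a : G), a ∈ Subgroup.center G ∧ ∀ x : G, ψ x = φ x * a) ↔
    (Subgroup.center G = ⊥ ∨ Nonempty (G ≃* Multiplicative (ZMod 2)) ∨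
      Nonempty (G ≃* Multiplicative (ZMod 2 × ZMod 2)) ∨
      Nonempty (G ≃* Multiplicative (ZMod 3))) := by
  constructor
  · intro H
    refine or_iff_not_imp_left.mpr fun hZ => ?_
    have hcomm := commute_of_forall_exists_mulAut H hZ
    have H' (ψ : Equiv.Perm G) : ∃ (φ : MulAut G) (a : G), ∀ x : G, ψ x = φ x * a := by
      obtain ⟨φ, a, -, h⟩ := H ψ fun x y => by
        rw [mul_assoc, hcomm x y, inv_mul_cancel_left, mul_assoc, hcomm (ψ x), inv_mul_cancel_left]
      exact ⟨φ, a, h⟩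
    have : Nontrivial G := not_subsingleton_iff_nontrivial.mp fun _ => hZ (Subsingleton.elim _ _)
    have hlt := Finite.one_lt_card (α := G)
    rcases card_le_three_or_isKleinFour H' with h3 | h4
    · obtain h | h : Nat.card G = 2 ∨ Nat.card G = 3 := by omega
      · exact .inl ⟨mulEquivOfPrimeCardEq (p := 2) h (by simp)⟩
      · exact .inr (.inr ⟨mulEquivOfPrimeCardEq (p := 3) h (by simp)⟩)
    · exact .inr (.inl IsKleinFour.nonempty_mulEquiv)
  · rintro (hZ | ⟨⟨e⟩⟩ | ⟨⟨e⟩⟩ | ⟨⟨e⟩⟩) ψ hψ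
    · have h1 := map_one_mem_center ψ hψ
      refine exists_mulAut_mul_center ψ h1 fun x y => ?_
      rw [hZ, Subgroup.mem_bot] at h1
      rw [h1, mul_one, map_mul_of_center_eq_bot hZ ψ hψ]
    · exact exists_mulAut_mul_center_of_mulEquiv (by decide) e ψ
    · exact exists_mulAut_mul_center_of_mulEquiv (by decide) e ψ
    · exact exists_mulAut_mul_center_of_mulEquiv (by decide) e ψ
end
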